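/- arXiv:1003.0059 — 5 statements merged into one kernel-verified Lean document; each statement's English description precedes it below -/
import Mathlib

section
/- (Lemma 9) Let k₁ ≥ 0 and k₂ ≥ 1 be integers, D ≥ 1 a real number, and f a continuous (complex-valued) function on [1,D]. Then the (k₁+k₂)-fold iterated integral ∫₁^D (log x₁)/x₁ ∫₁^{D/x₁} (log x₂)/x₂ ⋯ ∫₁^{D/(x₁⋯x_{k₁−1})} (log x_{k₁})/x_{k₁} · ∫₁^{D/(x₁⋯x_{k₁})} 1/x_{k₁+1} ⋯ ∫₁^{D/(x₁⋯x_{k₁+k₂−2})} 1/x_{k₁+k₂−1} ∫₁^{D/(x₁⋯x_{k₁+k₂−1})} f(x₁x₂⋯x_{k₁+k₂})/x_{k₁+k₂} dx_{k₁+k₂} ⋯ dx₁ (where the first k₁ integrations carry weight (log x_i)/x_i and the remaining k₂ carry weight 1/x_i) equals ∫₁^D f(x) (log x)^{2k₁+k₂−1} / ((2k₁+k₂−1)!·x) dx. -/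
open intervalIntegral

/-- The `(k₁+k₂)`-fold iterated integral in which the first `k₁` integrations carry the
weight `(log xᵢ)/xᵢ` and the remaining `k₂` carry the weight `1/xᵢ`, the function `f`
being evaluated at the product of all the variables (defined recursively, the accumulated
product being passed to `f`; `iterIntLog 0 0 f D = f 1`). -/
noncomputable def iterIntLog : ℕ → ℕ → (ℝ → ℂ) → ℝ → ℂ
  | 0, 0, f, _ => f 1
  | k₁ + 1, k₂, f, D => ∫ x in (1 : ℝ)..D, ((Real.log x / x : ℝ) : ℂ) *
      iterIntLog k₁ k₂ (fun y => f (x * y)) (D / x)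
  | 0, k₂ + 1, f, D => ∫ x in (1 : ℝ)..D, ((1 / x : ℝ) : ℂ) *
      iterIntLog 0 k₂ (fun y => f (x * y)) (D / x)

open MeasureTheory in
/-- Interchange of the order of integration over the triangle `a ≤ x ≤ y ≤ b`. -/
theorem integral_integral_swap_triangle {E : Type*} [NormedAddCommGroup E] [NormedSpace ℝ E]
    {a b : ℝ} (hab : a ≤ b) {F : ℝ → ℝ → E}
    (hF : ContinuousOn (Function.uncurry F) (Set.Icc a b ×ˢ Set.Icc a b)) :
    ∫ x in a..b, ∫ y in x..b, F x y = ∫ y in a..b, ∫ x in a..y, F x y := by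
  have hmeas : MeasurableSet {p : ℝ × ℝ | p.1 ≤ p.2} :=
    measurableSet_le measurable_fst measurable_snd
  have hint : IntegrableOn
      (Function.uncurry fun x y => {p : ℝ × ℝ | p.1 ≤ p.2}.indicator (Function.uncurry F) (x, y))
      (Set.uIoc a b ×ˢ Set.uIoc a b) := by
    rw [Set.uIoc_of_le hab]
    exact ((hF.integrableOn_compact (isCompact_Icc.prod isCompact_Icc)).mono_set
      (Set.prod_mono Set.Ioc_subset_Icc_self Set.Ioc_subset_Icc_self)).indicator hmeas
  have hswap := intervalIntegral_intervalIntegral_swap hint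
  convert hswap using 1
  · refine intervalIntegral.integral_congr_ae (.of_forall fun x hx => ?_)
    rw [Set.uIoc_of_le hab] at hx
    have hind : (fun y => {p : ℝ × ℝ | p.1 ≤ p.2}.indicator (Function.uncurry F) (x, y))
        = (Set.Ici x).indicator (F x) := by
      ext y; simp [Set.indicator_apply]
    have hset : Set.Ioc a b ∩ Set.Ici x = Set.Icc x b := by
      ext y
      simp only [Set.mem_inter_iff, Set.mem_Ioc, Set.mem_Ici, Set.mem_Icc]
      exact ⟨fun h => ⟨h.2, h.1.2⟩, fun h => ⟨⟨hx.1.trans_le h.1, h.2⟩, h.1⟩⟩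
    rw [hind, intervalIntegral.integral_of_le hab, setIntegral_indicator measurableSet_Ici, hset,
      integral_Icc_eq_integral_Ioc, intervalIntegral.integral_of_le hx.2]
  · refine intervalIntegral.integral_congr_ae (.of_forall fun y hy => ?_)
    rw [Set.uIoc_of_le hab] at hy
    have hind : (fun x => {p : ℝ × ℝ | p.1 ≤ p.2}.indicator (Function.uncurry F) (x, y))
        = (Set.Iic y).indicator (fun x => F x y) := by
      ext x; simp [Set.indicator_apply]
    rw [hind, intervalIntegral.integral_of_le hab, setIntegral_indicator measurableSet_Iic,
      Set.Ioc_inter_Iic, min_eq_right hy.2, intervalIntegral.integral_of_le hy.1.le]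

theorem integral_log_sub_log_pow_div (n : ℕ) {u : ℝ} (hu : 1 ≤ u) :
    ∫ x in (1 : ℝ)..u, 1 / x * ((Real.log u - Real.log x) ^ n / n.factorial)
      = Real.log u ^ (n + 1) / (n + 1).factorial := by
  have hpos : ∀ x ∈ Set.uIcc 1 u, x ≠ 0 := fun x hx => by
    rw [Set.uIcc_of_le hu] at hx; exact (zero_lt_one.trans_le hx.1).ne'
  have hderiv : ∀ x ∈ Set.uIcc 1 u,
      HasDerivAt (fun x => -((Real.log u - Real.log x) ^ (n + 1) / (n + 1).factorial))
        (1 / x * ((Real.log u - Real.log x) ^ n / n.factorial)) x := by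
    intro x hx
    have hx0 := hpos x hx
    refine (((((Real.hasDerivAt_log hx0).const_sub (Real.log u)).pow (n + 1)).div_const
      ((n + 1).factorial : ℝ)).neg).congr_deriv ?_
    have := n.factorial_ne_zero
    push_cast [Nat.factorial_succ]
    field_simp
  rw [intervalIntegral.integral_eq_sub_of_hasDerivAt hderiv]
  · simp
  · refine ContinuousOn.intervalIntegrable ?_
    fun_prop (disch := exact hpos)

theorem integral_log_mul_log_sub_log_pow_div (n : ℕ) {u : ℝ} (hu : 1 ≤ u) :
    ∫ x in (1 : ℝ)..u, Real.log x / x * ((Real.log u - Real.log x) ^ n / n.factorial)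
      = Real.log u ^ (n + 2) / (n + 2).factorial := by
  have hpos : ∀ x ∈ Set.uIcc 1 u, x ≠ 0 := fun x hx => by
    rw [Set.uIcc_of_le hu] at hx; exact (zero_lt_one.trans_le hx.1).ne'
  have hderiv : ∀ x ∈ Set.uIcc 1 u,
      HasDerivAt (fun x => -(Real.log x * ((Real.log u - Real.log x) ^ (n + 1) / (n + 1).factorial)
          + (Real.log u - Real.log x) ^ (n + 2) / (n + 2).factorial))
        (Real.log x / x * ((Real.log u - Real.log x) ^ n / n.factorial)) x := by
    intro x hx
    have hx0 := hpos x hx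
    have hlog := Real.hasDerivAt_log hx0
    have hsub := hlog.const_sub (Real.log u)
    refine ((hlog.mul ((hsub.pow (n + 1)).div_const ((n + 1).factorial : ℝ))).add
      ((hsub.pow (n + 2)).div_const ((n + 2).factorial : ℝ))).neg.congr_deriv ?_
    have := n.factorial_ne_zero
    have h2 : (n : ℝ) + 1 + 1 ≠ 0 := by positivity
    push_cast [Nat.factorial_succ]
    simp only [Pi.pow_apply, pow_succ]
    field_simp
    ring
  rw [intervalIntegral.integral_eq_sub_of_hasDerivAt hderiv]
  · simp
  · refine ContinuousOn.intervalIntegrable ?_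
    fun_prop (disch := exact hpos)

/-- A weighted integration over `x` of the integral formula for `y ↦ f (x * y)` on `[1, D / x]`
raises the exponent of the logarithm, provided the weight does so for the kernel
`(log u - log x) ^ n / n!`. -/
theorem integral_mul_integral_comp_mul_log_pow {D : ℝ} (hD : 1 ≤ D) {f : ℝ → ℂ}
    (hf : ContinuousOn f (Set.Icc 1 D)) {w : ℝ → ℝ} (hw : ContinuousOn w (Set.Icc 1 D)) {n m : ℕ}
    (hwm : ∀ u, 1 ≤ u → ∫ x in (1 : ℝ)..u, w x * ((Real.log u - Real.log x) ^ n / n.factorial)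
      = Real.log u ^ m / m.factorial) :
    ∫ x in (1 : ℝ)..D, (w x : ℂ) * ∫ y in (1 : ℝ)..(D / x),
        f (x * y) * (Real.log y : ℂ) ^ n / ((n.factorial : ℂ) * (y : ℂ))
      = ∫ u in (1 : ℝ)..D, f u * (Real.log u : ℂ) ^ m / ((m.factorial : ℂ) * (u : ℂ)) := by
  have hinner : ∀ x ∈ Set.uIcc 1 D,
      (w x : ℂ) * ∫ y in (1 : ℝ)..(D / x),
        f (x * y) * (Real.log y : ℂ) ^ n / ((n.factorial : ℂ) * (y : ℂ))
      = ∫ u in x..D, f u / u *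
          ((w x * ((Real.log u - Real.log x) ^ n / n.factorial) : ℝ) : ℂ) := by
    intro x hx
    rw [Set.uIcc_of_le hD] at hx
    have hx0 : 0 < x := zero_lt_one.trans_le hx.1
    have hsubst := intervalIntegral.smul_integral_comp_mul_left (a := 1) (b := D / x)
      (fun u => f u / u * ((w x * ((Real.log u - Real.log x) ^ n / n.factorial) : ℝ) : ℂ)) x
    rw [mul_one, mul_div_cancel₀ D hx0.ne'] at hsubst
    rw [← hsubst, ← intervalIntegral.integral_const_mul, ← intervalIntegral.integral_smul]
    refine intervalIntegral.integral_congr fun y hy => ?_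
    rw [Set.uIcc_of_le ((one_le_div hx0).2 hx.2)] at hy
    have hy0 : 0 < y := zero_lt_one.trans_le hy.1
    have hxc : (x : ℂ) ≠ 0 := by exact_mod_cast hx0.ne'
    have hyc : (y : ℂ) ≠ 0 := by exact_mod_cast hy0.ne'
    simp only [Real.log_mul hx0.ne' hy0.ne', add_sub_cancel_left, Complex.real_smul]
    push_cast
    field_simp
  rw [intervalIntegral.integral_congr hinner, integral_integral_swap_triangle hD]
  · refine intervalIntegral.integral_congr fun u hu => ?_
    rw [Set.uIcc_of_le hD] at hu
    rw [intervalIntegral.integral_const_mul, intervalIntegral.integral_ofReal, hwm u hu.1]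
    push_cast
    rw [div_mul_div_comm, mul_comm (u : ℂ)]
  · have hne : ∀ p ∈ Set.Icc (1 : ℝ) D ×ˢ Set.Icc (1 : ℝ) D, p.1 ≠ 0 ∧ p.2 ≠ 0 := fun p hp =>
      ⟨(zero_lt_one.trans_le hp.1.1).ne', (zero_lt_one.trans_le hp.2.1).ne'⟩
    have hf' : ContinuousOn (fun p : ℝ × ℝ => f p.2) (Set.Icc 1 D ×ˢ Set.Icc 1 D) :=
      hf.comp continuousOn_snd fun p hp => hp.2
    have hw' : ContinuousOn (fun p : ℝ × ℝ => w p.1) (Set.Icc 1 D ×ˢ Set.Icc 1 D) :=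
      hw.comp continuousOn_fst fun p hp => hp.1
    have hl₁ : ContinuousOn (fun p : ℝ × ℝ => Real.log p.1) (Set.Icc 1 D ×ˢ Set.Icc 1 D) :=
      continuousOn_fst.log fun p hp => (hne p hp).1
    have hl₂ : ContinuousOn (fun p : ℝ × ℝ => Real.log p.2) (Set.Icc 1 D ×ˢ Set.Icc 1 D) :=
      continuousOn_snd.log fun p hp => (hne p hp).2
    exact (hf'.div (Complex.continuous_ofReal.comp_continuousOn continuousOn_snd)
      fun p hp => Complex.ofReal_ne_zero.2 (hne p hp).2).mul
        (Complex.continuous_ofReal.comp_continuousOn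
          (hw'.mul (((hl₂.sub hl₁).pow n).div_const _)))

theorem continuousOn_comp_mul_left_Icc {D x : ℝ} {f : ℝ → ℂ} (hf : ContinuousOn f (Set.Icc 1 D))
    (hx : 1 ≤ x) : ContinuousOn (fun y => f (x * y)) (Set.Icc 1 (D / x)) := by
  have hx0 : 0 < x := zero_lt_one.trans_le hx
  refine hf.comp (by fun_prop) fun y hy => ⟨one_le_mul_of_one_le_of_one_le hx hy.1, ?_⟩
  rw [mul_comm]
  exact (le_div_iff₀ hx0).1 hy.2

theorem iterIntLog_zero_succ_eq (k : ℕ) (D : ℝ) (hD : 1 ≤ D) (f : ℝ → ℂ)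
    (hf : ContinuousOn f (Set.Icc 1 D)) :
    iterIntLog 0 (k + 1) f D
      = ∫ x in (1 : ℝ)..D, f x * (Real.log x : ℂ) ^ k / ((k.factorial : ℂ) * (x : ℂ)) := by
  induction k generalizing D f with
  | zero =>
    simp only [iterIntLog]
    refine intervalIntegral.integral_congr fun x _ => ?_
    simp [div_eq_mul_inv, mul_comm]
  | succ k ih =>
    have hw : ContinuousOn (fun x : ℝ => 1 / x) (Set.Icc 1 D) :=
      continuousOn_const.div continuousOn_id fun x hx => (zero_lt_one.trans_le hx.1).ne'
    rw [iterIntLog, ← integral_mul_integral_comp_mul_log_pow hD hf hw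
      fun u hu => integral_log_sub_log_pow_div k hu]
    refine intervalIntegral.integral_congr fun x hx => ?_
    rw [Set.uIcc_of_le hD] at hx
    rw [ih _ ((one_le_div (zero_lt_one.trans_le hx.1)).2 hx.2) _
      (continuousOn_comp_mul_left_Icc hf hx.1)]

/-- (Lemma 9) For integers `k₁ ≥ 0`, `k₂ ≥ 1`, real `D ≥ 1` and `f` continuous on `[1,D]`,
the iterated integral with `k₁` weights `(log x)/x` and `k₂` weights `1/x` equals
`∫₁^D f(x) (log x)^{2k₁+k₂-1} / ((2k₁+k₂-1)!·x) dx`. -/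
theorem iterIntLog_eq (k₁ k₂ : ℕ) (hk₂ : 1 ≤ k₂) (D : ℝ) (hD : 1 ≤ D)
    (f : ℝ → ℂ) (hf : ContinuousOn f (Set.Icc 1 D)) :
    iterIntLog k₁ k₂ f D
      = ∫ x in (1 : ℝ)..D,
          f x * ((Real.log x : ℂ)) ^ (2 * k₁ + k₂ - 1) /
            (((2 * k₁ + k₂ - 1).factorial : ℂ) * (x : ℂ)) := by
  obtain ⟨k, rfl⟩ := Nat.exists_eq_add_of_le' hk₂
  induction k₁ generalizing D f with
  | zero => simpa using iterIntLog_zero_succ_eq k D hD f hf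
  | succ n ih =>
    have hw : ContinuousOn (fun x : ℝ => Real.log x / x) (Set.Icc 1 D) :=
      have h0 : ∀ x ∈ Set.Icc 1 D, x ≠ 0 := fun x hx => (zero_lt_one.trans_le hx.1).ne'
      (continuousOn_id.log h0).div continuousOn_id h0
    have hexp : 2 * (n + 1) + (k + 1) - 1 = 2 * n + (k + 1) - 1 + 2 := by omega
    rw [iterIntLog, hexp, ← integral_mul_integral_comp_mul_log_pow hD hf hw
      fun u hu => integral_log_mul_log_sub_log_pow_div _ hu]
    refine intervalIntegral.integral_congr fun x hx => ?_
    rw [Set.uIcc_of_le hD] at hx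
    rw [ih _ ((one_le_div (zero_lt_one.trans_le hx.1)).2 hx.2) _
      (continuousOn_comp_mul_left_Icc hf hx.1)]
end

section
/- For every squarefree positive integer j, (μ * Λ * Λ)(j) = μ(j) · Σ over ordered pairs (p₁, p₂) of primes with p₁p₂ | j of log p₁ · log p₂. -/
open ArithmeticFunction

/-- The sum over ordered `l`-tuples `(p₁, …, p_l)` of primes with `p₁⋯p_l ∣ j` of
`log p₁ ⋯ log p_l`. -/
noncomputable def primeTupleLogSum (l : ℕ) (j : ℕ) : ℝ :=
  ∑' p : Fin l → ℕ, if (∀ i, (p i).Prime) ∧ (∏ i, p i) ∣ j then ∏ i, Real.log (p i) else 0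

/-- On squarefree arguments, convolution with `Λ` only sees the prime divisors. -/
theorem mul_vonMangoldt_apply_of_squarefree (f : ArithmeticFunction ℝ) {n : ℕ}
    (hn : Squarefree n) :
    (f * vonMangoldt) n = ∑ p ∈ n.primeFactors, f (n / p) * Real.log p := by
  rw [ArithmeticFunction.mul_apply,
    Nat.sum_divisorsAntidiagonal' (f := fun a b => f a * vonMangoldt b)]
  have hsub : n.primeFactors ⊆ n.divisors := fun p hp =>
    Nat.mem_divisors.2 ⟨Nat.dvd_of_mem_primeFactors hp, hn.ne_zero⟩
  rw [← Finset.sum_subset hsub]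
  · refine Finset.sum_congr rfl fun p hp => ?_
    rw [vonMangoldt_apply_prime (Nat.prime_of_mem_primeFactors hp)]
  · intro d hd hnot
    have hdn := Nat.dvd_of_mem_divisors hd
    rw [vonMangoldt_eq_zero_iff.2, mul_zero]
    intro hpow
    have hprime : d.Prime :=
      Nat.squarefree_and_prime_pow_iff_prime.1 ⟨hn.squarefree_of_dvd hdn, hpow⟩
    exact hnot (Nat.mem_primeFactors.2 ⟨hprime, hdn, hn.ne_zero⟩)

theorem moebius_div_prime_of_squarefree {n p : ℕ} (hn : Squarefree n) (hp : p ∈ n.primeFactors) :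
    moebius (n / p) = -moebius n := by
  obtain ⟨m, rfl⟩ := Nat.dvd_of_mem_primeFactors hp
  have hprime := Nat.prime_of_mem_primeFactors hp
  rw [Nat.mul_div_cancel_left _ hprime.pos,
    isMultiplicative_moebius.map_mul_of_coprime (Nat.coprime_of_squarefree_mul hn),
    moebius_apply_prime hprime]
  ring

theorem primeTupleLogSum_two {j : ℕ} (hj : j ≠ 0) :
    primeTupleLogSum 2 j =
      ∑ p ∈ j.primeFactors, ∑ q ∈ (j / p).primeFactors, Real.log p * Real.log q := by
  unfold primeTupleLogSum
  have hmem (p q : ℕ) : (p.Prime ∧ q.Prime) ∧ p * q ∣ j ↔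
      p ∈ j.primeFactors ∧ q ∈ (j / p).primeFactors := by
    constructor
    · rintro ⟨⟨hp, hq⟩, m, rfl⟩
      rw [mul_assoc] at hj ⊢
      rw [Nat.mul_div_cancel_left _ hp.pos]
      exact ⟨Nat.mem_primeFactors.2 ⟨hp, Dvd.intro _ rfl, hj⟩,
        Nat.mem_primeFactors.2 ⟨hq, Dvd.intro _ rfl, right_ne_zero_of_mul hj⟩⟩
    · rintro ⟨hp, hq⟩
      exact ⟨⟨Nat.prime_of_mem_primeFactors hp, Nat.prime_of_mem_primeFactors hq⟩,
        (Nat.dvd_div_iff_mul_dvd (Nat.dvd_of_mem_primeFactors hp)).1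
          (Nat.dvd_of_mem_primeFactors hq)⟩
  have hsub (p : ℕ) (hp : p ∈ j.primeFactors) : (j / p).primeFactors ⊆ j.primeFactors :=
    Nat.primeFactors_mono (Nat.div_dvd_of_dvd (Nat.dvd_of_mem_primeFactors hp)) hj
  rw [← (finTwoArrowEquiv ℕ).symm.tsum_eq]
  simp only [finTwoArrowEquiv_symm_apply, Fin.forall_fin_two, Fin.prod_univ_two,
    Matrix.cons_val_zero, Matrix.cons_val_one, hmem]
  rw [tsum_eq_sum (s := j.primeFactors ×ˢ j.primeFactors), Finset.sum_product]
  · refine Finset.sum_congr rfl fun p hp => ?_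
    rw [← Finset.sum_subset (hsub p hp)]
    · exact Finset.sum_congr rfl fun q hq => if_pos ⟨hp, hq⟩
    · exact fun q _ hq => if_neg fun h => hq h.2
  · exact fun x hx => if_neg fun h => hx (Finset.mem_product.2 ⟨h.1, hsub _ h.1 h.2⟩)

/-- For every squarefree positive integer `j`,
`(μ * Λ * Λ)(j) = μ(j) · Σ_{(p₁,p₂) primes, p₁p₂ ∣ j} log p₁ log p₂`
(sum over ordered pairs). -/
theorem moebius_mul_vonMangoldt_sq_squarefree (j : ℕ) (hj : 0 < j) (hsq : Squarefree j) :
    ((moebius : ArithmeticFunction ℤ) * vonMangoldt * vonMangoldt : ArithmeticFunction ℝ) j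
      = (moebius j : ℝ) * primeTupleLogSum 2 j := by
  rw [mul_vonMangoldt_apply_of_squarefree _ hsq, primeTupleLogSum_two hj.ne', Finset.mul_sum]
  refine Finset.sum_congr rfl fun p hp => ?_
  have hsq' : Squarefree (j / p) :=
    hsq.squarefree_of_dvd (Nat.div_dvd_of_dvd (Nat.dvd_of_mem_primeFactors hp))
  rw [mul_vonMangoldt_apply_of_squarefree _ hsq', Finset.sum_mul, Finset.mul_sum]
  refine Finset.sum_congr rfl fun q hq => ?_
  rw [intCoe_apply, moebius_div_prime_of_squarefree hsq' hq,
    moebius_div_prime_of_squarefree hsq hp, neg_neg]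
  ring
end

section
/- For every squarefree positive integer j, (μ * Λ * Λ * Λ)(j) = −μ(j) · Σ over ordered triples (p₁, p₂, p₃) of primes with p₁p₂p₃ | j of log p₁ · log p₂ · log p₃. -/
open ArithmeticFunction

theorem mul_vonMangoldt_apply_squarefree (f : ArithmeticFunction ℝ) {j : ℕ}
    (hsq : Squarefree j) :
    (f * vonMangoldt) j = ∑ p ∈ j.primeFactors, Real.log p * f (j / p) := by
  rw [mul_comm, mul_apply,
    Nat.sum_divisorsAntidiagonal (f := fun a b => vonMangoldt a * f b)]
  symm
  refine Finset.sum_subset_zero_on_sdiff ?_ ?_ ?_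
  · intro p hp
    exact Nat.mem_divisors.2 ⟨Nat.dvd_of_mem_primeFactors hp, hsq.ne_zero⟩
  · intro d hd
    obtain ⟨hd, hdp⟩ := Finset.mem_sdiff.1 hd
    have hdj := Nat.dvd_of_mem_divisors hd
    have hpp : ¬ IsPrimePow d := fun h => hdp <| Nat.mem_primeFactors.2
      ⟨Nat.squarefree_and_prime_pow_iff_prime.1 ⟨hsq.squarefree_of_dvd hdj, h⟩, hdj, hsq.ne_zero⟩
    rw [vonMangoldt_eq_zero_iff.2 hpp, zero_mul]
  · intro p hp
    rw [vonMangoldt_apply_prime (Nat.prime_of_mem_primeFactors hp)]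

theorem summable_primeTupleLogSum (l : ℕ) {j : ℕ} (hj : j ≠ 0) :
    Summable fun p : Fin l → ℕ =>
      if (∀ i, (p i).Prime) ∧ (∏ i, p i) ∣ j then ∏ i, Real.log (p i) else 0 := by
  refine summable_of_ne_finset_zero (s := Fintype.piFinset fun _ => j.primeFactors) ?_
  intro p hp
  refine if_neg fun h => hp <| Fintype.mem_piFinset.2 fun i => ?_
  exact Nat.mem_primeFactors.2
    ⟨h.1 i, (Finset.dvd_prod_of_mem p (Finset.mem_univ i)).trans h.2, hj⟩

theorem primeTupleLogSum_zero (j : ℕ) : primeTupleLogSum 0 j = 1 := by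
  simp [primeTupleLogSum]

theorem primeTupleLogSum_succ (l : ℕ) {j : ℕ} (hj : j ≠ 0) :
    primeTupleLogSum (l + 1) j =
      ∑ p ∈ j.primeFactors, Real.log p * primeTupleLogSum l (j / p) := by
  have hs := summable_primeTupleLogSum (l + 1) hj
  rw [← (Fin.consEquiv fun _ : Fin (l + 1) => ℕ).summable_iff] at hs
  rw [primeTupleLogSum, ← (Fin.consEquiv fun _ : Fin (l + 1) => ℕ).tsum_eq]
  refine (Summable.tsum_prod hs).trans ?_
  rw [tsum_eq_sum (s := j.primeFactors)]
  · refine Finset.sum_congr rfl fun p hp => ?_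
    rw [primeTupleLogSum, ← tsum_mul_left]
    refine tsum_congr fun q => ?_
    have hdvd : p * ∏ i, q i ∣ j ↔ ∏ i, q i ∣ j / p :=
      (Nat.dvd_div_iff_mul_dvd (Nat.dvd_of_mem_primeFactors hp)).symm
    simp [Fin.consEquiv, Fin.forall_fin_succ, Fin.prod_univ_succ, hdvd,
      Nat.prime_of_mem_primeFactors hp]
  · intro p hp
    refine (tsum_congr fun q => if_neg fun h => hp ?_).trans tsum_zero
    have hdvd := (Finset.dvd_prod_of_mem _ (Finset.mem_univ 0)).trans h.2
    exact Nat.mem_primeFactors.2 ⟨h.1 0, hdvd, hj⟩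

theorem moebius_div_prime {j p : ℕ} (hsq : Squarefree j) (hp : p ∈ j.primeFactors) :
    moebius (j / p) = -moebius j := by
  obtain ⟨m, rfl⟩ := Nat.dvd_of_mem_primeFactors hp
  have hpp := Nat.prime_of_mem_primeFactors hp
  rw [Nat.mul_div_cancel_left m hpp.pos,
    isMultiplicative_moebius.map_mul_of_coprime (Nat.coprime_of_squarefree_mul hsq),
    moebius_apply_prime hpp]
  ring

theorem moebius_mul_vonMangoldt_pow_squarefree (l : ℕ) {j : ℕ} (hsq : Squarefree j) :
    (((moebius : ArithmeticFunction ℤ) : ArithmeticFunction ℝ) * vonMangoldt ^ l) j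
      = (-1) ^ l * (moebius j : ℝ) * primeTupleLogSum l j := by
  induction l generalizing j with
  | zero => simp [primeTupleLogSum_zero]
  | succ l ih =>
    rw [pow_succ, ← mul_assoc, mul_vonMangoldt_apply_squarefree _ hsq,
      primeTupleLogSum_succ l hsq.ne_zero, Finset.mul_sum]
    refine Finset.sum_congr rfl fun p hp => ?_
    rw [ih (hsq.squarefree_of_dvd (Nat.div_dvd_of_dvd (Nat.dvd_of_mem_primeFactors hp))),
      moebius_div_prime hsq hp]
    push_cast
    ring

/-- For every squarefree positive integer `j`,
`(μ * Λ * Λ * Λ)(j) = -μ(j) · Σ_{(p₁,p₂,p₃) primes, p₁p₂p₃ ∣ j} log p₁ log p₂ log p₃`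
(sum over ordered triples). -/
theorem moebius_mul_vonMangoldt_cube_squarefree (j : ℕ) (hj : 0 < j) (hsq : Squarefree j) :
    ((moebius : ArithmeticFunction ℤ) * vonMangoldt * vonMangoldt * vonMangoldt :
        ArithmeticFunction ℝ) j
      = -(moebius j : ℝ) * primeTupleLogSum 3 j := by
  have hpow := moebius_mul_vonMangoldt_pow_squarefree 3 hsq
  rw [pow_succ, pow_two, ← mul_assoc, ← mul_assoc] at hpow
  rw [hpow]
  ring
end

section
/- (Euler product Y(α,β), (4.23)–(4.24)) For complex α, β with |α| ≤ 1/8 and |β| ≤ 1/8: for every prime p one has the local identity (1 − 1/p²)·( 1 + (1/(p+1))·( (1 − p^{−1−α−β}) / ((1 − p^{−1−α})(1 − p^{−1−β})) − 1 ) ) = 1 − (p^α − 1)(p^β − 1) / ((p^{1+α} − 1)(p^{1+β} − 1)); the infinite product Y(α,β) = ∏_p ( 1 − (p^α − 1)(p^β − 1) / ((p^{1+α} − 1)(p^{1+β} − 1)) ) over all primes converges; and there is an absolute constant C such that |Y(α,β) − 1| ≤ C(|α| + |β|) for all such α, β. -/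
/-- The Euler factor of `Y(α,β)` at the prime `p`. -/
noncomputable def eulerFactorY (α β : ℂ) (p : ℕ) : ℂ :=
  1 - ((p : ℂ) ^ α - 1) * ((p : ℂ) ^ β - 1) /
    (((p : ℂ) ^ (1 + α) - 1) * ((p : ℂ) ^ (1 + β) - 1))

/-- The real exponential satisfies `exp x - 1 ≤ x * exp x`. -/
theorem Real.exp_sub_one_le_mul_exp (x : ℝ) : Real.exp x - 1 ≤ x * Real.exp x := by
  have h := mul_le_mul_of_nonneg_left (Real.add_one_le_exp (-x)) (Real.exp_pos x).le
  rw [← Real.exp_add, add_neg_cancel, Real.exp_zero] at h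
  linarith

/-- A product of factors `1 + f i` differs from `1` by at most `exp (∑ ‖f i‖) - 1`. -/
theorem norm_tprod_one_add_sub_one_le_exp {ι : Type*} {f : ι → ℂ}
    (hf : Summable fun i => ‖f i‖) :
    ‖(∏' i, (1 + f i)) - 1‖ ≤ Real.exp (∑' i, ‖f i‖) - 1 := by
  have hprod := (multipliable_one_add_of_summable hf).hasProd
  refine le_of_tendsto ((Filter.Tendsto.sub_const hprod 1).norm)
    (Filter.Eventually.of_forall fun t => ?_)
  refine (t.norm_prod_one_add_sub_one_le f).trans ?_
  have := hf.sum_le_tsum t fun i _ => norm_nonneg _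
  gcongr

/-- `|p ^ α - 1|` is small when `α` is small, with polynomial dependence on `p`. -/
theorem norm_natCast_cpow_sub_one_le {p : ℕ} (hp : 2 ≤ p) {α : ℂ} (hα : ‖α‖ ≤ 1 / 8) :
    ‖(p : ℂ) ^ α - 1‖ ≤ 8 * ‖α‖ * (p : ℝ) ^ (1 / 4 : ℝ) := by
  have hp1 : (1 : ℝ) ≤ p := by exact_mod_cast (by lia : 1 ≤ p)
  have hp0 : (0 : ℝ) < p := by linarith
  have hlog : 0 ≤ Real.log p := Real.log_nonneg hp1
  have hnorm : ‖Complex.log p * α‖ = Real.log p * ‖α‖ := by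
    rw [norm_mul, ← Complex.natCast_log, Complex.norm_real, Real.norm_of_nonneg hlog]
  have hexp : ‖Complex.exp (Complex.log p * α) - 1‖ ≤
      ‖Complex.log p * α‖ * Real.exp ‖Complex.log p * α‖ := by
    simpa using Complex.norm_exp_sub_sum_le_norm_mul_exp (Complex.log p * α) 1
  rw [Complex.cpow_def_of_ne_zero (by exact_mod_cast hp0.ne')]
  refine hexp.trans ?_
  rw [hnorm, ← Real.rpow_def_of_pos hp0]
  have h1 : Real.log p ≤ 8 * (p : ℝ) ^ (1 / 8 : ℝ) := by
    have := Real.log_le_rpow_div hp0.le (show (0 : ℝ) < 1 / 8 by norm_num)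
    linarith
  have h2 : (p : ℝ) ^ ‖α‖ ≤ (p : ℝ) ^ (1 / 8 : ℝ) := Real.rpow_le_rpow_of_exponent_le hp1 hα
  have h3 : (p : ℝ) ^ (1 / 4 : ℝ) = (p : ℝ) ^ (1 / 8 : ℝ) * (p : ℝ) ^ (1 / 8 : ℝ) := by
    rw [← Real.rpow_add hp0]; norm_num
  calc Real.log p * ‖α‖ * (p : ℝ) ^ ‖α‖
      ≤ 8 * (p : ℝ) ^ (1 / 8 : ℝ) * ‖α‖ * (p : ℝ) ^ (1 / 8 : ℝ) := by gcongr
    _ = 8 * ‖α‖ * (p : ℝ) ^ (1 / 4 : ℝ) := by rw [h3]; ring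

/-- The factors `p ^ (1 + α) - 1` are bounded below by a multiple of `p ^ (7 / 8)`. -/
theorem le_norm_natCast_cpow_one_add_sub_one {p : ℕ} (hp : 2 ≤ p) {α : ℂ}
    (hα : ‖α‖ ≤ 1 / 8) :
    (p : ℝ) ^ (7 / 8 : ℝ) / 4 ≤ ‖(p : ℂ) ^ (1 + α) - 1‖ := by
  have hp2 : (2 : ℝ) ≤ p := by exact_mod_cast hp
  have hp0 : (0 : ℝ) < p := by linarith
  have hre : 7 / 8 ≤ (1 + α).re := by
    have := (abs_le.mp ((Complex.abs_re_le_norm α).trans hα)).1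
    rw [Complex.add_re, Complex.one_re]
    linarith
  have h1 : (p : ℝ) ^ (7 / 8 : ℝ) ≤ ‖(p : ℂ) ^ (1 + α)‖ := by
    rw [Complex.norm_natCast_cpow_of_pos (by lia)]
    exact Real.rpow_le_rpow_of_exponent_le (by linarith) hre
  have h2 : 4 / 3 ≤ (p : ℝ) ^ (7 / 8 : ℝ) := by
    have h : (4 / 3 : ℝ) ≤ 2 ^ (7 / 8 : ℝ) := by
      refine le_of_pow_le_pow_left₀ (n := 8) (by norm_num) (by positivity) ?_
      rw [← Real.rpow_mul_natCast (by norm_num)]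
      norm_num
    exact h.trans (Real.rpow_le_rpow (by norm_num) hp2 (by norm_num))
  have h3 := norm_sub_norm_le ((p : ℂ) ^ (1 + α)) 1
  rw [norm_one] at h3
  linarith

theorem natCast_cpow_one_add_sub_one_ne_zero {p : ℕ} (hp : 2 ≤ p) {α : ℂ}
    (hα : ‖α‖ ≤ 1 / 8) : (p : ℂ) ^ (1 + α) - 1 ≠ 0 := by
  have hp0 : (0 : ℝ) < p := by exact_mod_cast (by lia : 0 < p)
  exact norm_pos_iff.mp
    (lt_of_lt_of_le (by positivity) (le_norm_natCast_cpow_one_add_sub_one hp hα))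

/-- The Euler factor of `Y(α,β)` differs from `1` by `O(|α| p ^ (-5/4))`. -/
theorem norm_eulerFactorY_sub_one_le {p : ℕ} (hp : 2 ≤ p) {α β : ℂ}
    (hα : ‖α‖ ≤ 1 / 8) (hβ : ‖β‖ ≤ 1 / 8) :
    ‖eulerFactorY α β p - 1‖ ≤ 128 * ‖α‖ * (p : ℝ) ^ (-(5 / 4) : ℝ) := by
  have hp0 : (0 : ℝ) < p := by exact_mod_cast (by lia : 0 < p)
  have hβ' : ‖(p : ℂ) ^ β - 1‖ ≤ (p : ℝ) ^ (1 / 4 : ℝ) :=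
    (norm_natCast_cpow_sub_one_le hp hβ).trans
      (mul_le_of_le_one_left (by positivity) (by linarith))
  have hpow : (p : ℝ) ^ (-(5 / 4) : ℝ) *
      ((p : ℝ) ^ (7 / 8 : ℝ) * (p : ℝ) ^ (7 / 8 : ℝ)) =
      (p : ℝ) ^ (1 / 4 : ℝ) * (p : ℝ) ^ (1 / 4 : ℝ) := by
    simp only [← Real.rpow_add hp0]; norm_num
  rw [eulerFactorY, sub_sub_cancel_left, norm_neg, norm_div, norm_mul, norm_mul]
  calc _ ≤ 8 * ‖α‖ * (p : ℝ) ^ (1 / 4 : ℝ) * (p : ℝ) ^ (1 / 4 : ℝ) /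
        ((p : ℝ) ^ (7 / 8 : ℝ) / 4 * ((p : ℝ) ^ (7 / 8 : ℝ) / 4)) := by
        gcongr
        · exact norm_natCast_cpow_sub_one_le hp hα
        · exact le_norm_natCast_cpow_one_add_sub_one hp hα
        · exact le_norm_natCast_cpow_one_add_sub_one hp hβ
    _ = 128 * ‖α‖ * (p : ℝ) ^ (-(5 / 4) : ℝ) := by
        rw [div_eq_iff (by positivity)]
        linear_combination (-8 * ‖α‖) * hpow

/-- The local identity for the Euler factor of `Y(α,β)`. -/
theorem local_identity_eulerFactorY {p : ℕ} (hp : 2 ≤ p) {α β : ℂ}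
    (hα : ‖α‖ ≤ 1 / 8) (hβ : ‖β‖ ≤ 1 / 8) :
    (1 - 1 / (p : ℂ) ^ 2) *
      (1 + (1 / ((p : ℂ) + 1)) *
        ((1 - (p : ℂ) ^ (-1 - α - β)) /
          ((1 - (p : ℂ) ^ (-1 - α)) * (1 - (p : ℂ) ^ (-1 - β))) - 1))
      = eulerFactorY α β p := by
  have hp0 : (p : ℂ) ≠ 0 := by exact_mod_cast (by lia : p ≠ 0)
  have hp1 : (p : ℂ) + 1 ≠ 0 := by exact_mod_cast p.succ_ne_zero
  have hA := natCast_cpow_one_add_sub_one_ne_zero hp hα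
  have hB := natCast_cpow_one_add_sub_one_ne_zero hp hβ
  have ha : (p : ℂ) ^ α ≠ 0 := by simp [Complex.cpow_eq_zero_iff, hp0]
  have hb : (p : ℂ) ^ β ≠ 0 := by simp [Complex.cpow_eq_zero_iff, hp0]
  simp only [eulerFactorY, Complex.cpow_sub _ _ hp0, Complex.cpow_add _ _ hp0,
    Complex.cpow_neg_one, Complex.cpow_one] at hA hB ⊢
  generalize (p : ℂ) ^ α = a at *
  generalize (p : ℂ) ^ β = b at *
  generalize (p : ℂ) = P at *
  have hA' : 1 - P⁻¹ / a = (P * a - 1) / (P * a) := by field_simp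
  have hB' : 1 - P⁻¹ / b = (P * b - 1) / (P * b) := by field_simp
  rw [hA', hB']
  field_simp
  ring

/-- (Euler product `Y(α,β)`, (4.23)–(4.24)) For complex `α, β` with `|α| ≤ 1/8`, `|β| ≤ 1/8`:
the local identity holds at every prime, the infinite product `Y(α,β)` converges, and
`|Y(α,β) - 1| ≤ C(|α| + |β|)` for an absolute constant `C`. -/
theorem eulerProductY :
    ∃ C : ℝ, 0 < C ∧ ∀ α β : ℂ, ‖α‖ ≤ 1/8 → ‖β‖ ≤ 1/8 →
      (∀ p : ℕ, p.Prime →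
          (1 - 1 / (p : ℂ) ^ 2) *
            (1 + (1 / ((p : ℂ) + 1)) *
              ((1 - (p : ℂ) ^ (-1 - α - β)) /
                ((1 - (p : ℂ) ^ (-1 - α)) * (1 - (p : ℂ) ^ (-1 - β))) - 1))
            = eulerFactorY α β p) ∧
      Multipliable (fun p : Nat.Primes => eulerFactorY α β p) ∧
      ‖(∏' p : Nat.Primes, eulerFactorY α β p) - 1‖ ≤ C * (‖α‖ + ‖β‖) := by
  have hS : Summable fun p : Nat.Primes => (p : ℝ) ^ (-(5 / 4) : ℝ) :=
    Nat.Primes.summable_rpow.mpr (by norm_num)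
  set S : ℝ := ∑' p : Nat.Primes, (p : ℝ) ^ (-(5 / 4) : ℝ)
  have hS0 : 0 ≤ S := tsum_nonneg fun p => by positivity
  refine ⟨128 * S * Real.exp (16 * S) + 1, by positivity, fun α β hα hβ =>
    ⟨fun p hp => local_identity_eulerFactorY hp.two_le hα hβ, ?_⟩⟩
  have hbound (p : Nat.Primes) := norm_eulerFactorY_sub_one_le p.2.two_le hα hβ
  have hsum : Summable fun p : Nat.Primes => ‖eulerFactorY α β p - 1‖ :=
    (hS.mul_left (128 * ‖α‖)).of_nonneg_of_le (fun _ => norm_nonneg _) hbound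
  have hle : ∑' p : Nat.Primes, ‖eulerFactorY α β p - 1‖ ≤ 128 * ‖α‖ * S :=
    (hsum.tsum_le_tsum hbound (hS.mul_left _)).trans_eq tsum_mul_left
  have hmul := multipliable_one_add_of_summable hsum
  have hnorm := norm_tprod_one_add_sub_one_le_exp hsum
  simp only [add_sub_cancel] at hmul hnorm
  refine ⟨hmul, hnorm.trans ?_⟩
  calc Real.exp (∑' p : Nat.Primes, ‖eulerFactorY α β p - 1‖) - 1
      ≤ Real.exp (128 * ‖α‖ * S) - 1 := by gcongr
    _ ≤ 128 * ‖α‖ * S * Real.exp (128 * ‖α‖ * S) := Real.exp_sub_one_le_mul_exp _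
    _ ≤ 128 * ‖α‖ * S * Real.exp (16 * S) := by
        gcongr
        linarith
    _ = 128 * S * Real.exp (16 * S) * ‖α‖ := by ring
    _ ≤ (128 * S * Real.exp (16 * S) + 1) * (‖α‖ + ‖β‖) := by
        gcongr
        · linarith
        · linarith [norm_nonneg β]
end

section
/- (Estimate (4.33)) There is an absolute constant C > 0 such that for all complex α, β with |α| ≤ 1/8, |β| ≤ 1/8 and for every prime p, | (p^{1+α+β} − 1) / ( (p^{1+α} − 1)(p^{1+β} − 1) + (p^{1+α+β} − 1) ) − 1/p | ≤ C·p^{−3/2}. -/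
/-- If `P = t ^ 8` with `t ≥ 1` and `u`, `v` have norm at most `t`, then `P + 1 - u - v` is
bounded below by a constant multiple of `P` as soon as `P ≥ 2`. -/
lemma norm_add_one_sub_sub_ge {P t : ℝ} (hP : 2 ≤ P) (ht : 1 ≤ t) (hPt : t ^ 8 = P) {u v : ℂ}
    (hu : ‖u‖ ≤ t) (hv : ‖v‖ ≤ t) : 3 / 8 * P ≤ ‖(P : ℂ) + 1 - u - v‖ := by
  have bernoulli : 1 + 8 * (t - 1) ≤ t ^ 8 := by
    have := one_add_mul_le_pow (a := t - 1) (by linarith) 8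
    simpa using this
  have h₁ : ‖(P : ℂ) + 1‖ = P + 1 := by
    rw [← Complex.ofReal_one, ← Complex.ofReal_add, Complex.norm_of_nonneg (by linarith)]
  have h₂ := norm_sub_norm_le ((P : ℂ) + 1) u
  have h₃ := norm_sub_norm_le ((P : ℂ) + 1 - u) v
  linarith

/-- The error term of the fraction factors completely. -/
lemma fraction_sub_one_div_eq {P x y : ℂ} (hP : P ≠ 0) (hx : x ≠ 0) (hy : y ≠ 0)
    (h : P + 1 - x⁻¹ - y⁻¹ ≠ 0) :
    (P * x * y - 1) / ((P * x - 1) * (P * y - 1) + (P * x * y - 1)) - 1 / P =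
      -((1 - x⁻¹) * (1 - y⁻¹)) / (P * (P + 1 - x⁻¹ - y⁻¹)) := by
  have hD : (P * x - 1) * (P * y - 1) + (P * x * y - 1) =
      P * x * y * (P + 1 - x⁻¹ - y⁻¹) := by
    field_simp
    ring
  rw [hD, div_sub_div _ _ (by positivity) hP, div_eq_div_iff (by positivity) (by positivity)]
  field_simp
  ring

lemma norm_natCast_cpow_inv_le {p : ℕ} (hp : 1 ≤ p) {s : ℂ} {r : ℝ} (hs : ‖s‖ ≤ r) :
    ‖((p : ℂ) ^ s)⁻¹‖ ≤ (p : ℝ) ^ r := by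
  rw [← Complex.cpow_neg, Complex.norm_natCast_cpow_of_pos hp]
  refine Real.rpow_le_rpow_of_exponent_le (by exact_mod_cast hp) ?_
  exact (Complex.re_le_norm _).trans (by rwa [norm_neg])

/-- (Estimate (4.33)) There is an absolute constant `C > 0` such that for all complex
`α, β` with `|α| ≤ 1/8`, `|β| ≤ 1/8` and every prime `p`,
`|(p^{1+α+β} - 1)/((p^{1+α}-1)(p^{1+β}-1) + (p^{1+α+β}-1)) - 1/p| ≤ C p^{-3/2}`. -/
theorem prime_fraction_estimate :
    ∃ C : ℝ, 0 < C ∧ ∀ α β : ℂ, ‖α‖ ≤ 1/8 → ‖β‖ ≤ 1/8 → ∀ p : ℕ, p.Prime →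
      ‖((p : ℂ) ^ (1 + α + β) - 1) /
          (((p : ℂ) ^ (1 + α) - 1) * ((p : ℂ) ^ (1 + β) - 1) + ((p : ℂ) ^ (1 + α + β) - 1))
        - 1 / (p : ℂ)‖ ≤ C * (p : ℝ) ^ (-(3 : ℝ)/2) := by
  refine ⟨11, by norm_num, fun α β hα hβ p hp => ?_⟩
  have hp0 : (p : ℂ) ≠ 0 := by exact_mod_cast hp.ne_zero
  have hp2 : (2 : ℝ) ≤ p := by exact_mod_cast hp.two_le
  have hp_nonneg : (0 : ℝ) ≤ p := by positivity
  obtain ⟨t, ht⟩ : ∃ t : ℝ, t = (p : ℝ) ^ (1 / 8 : ℝ) := ⟨_, rfl⟩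
  have ht1 : 1 ≤ t := ht ▸ Real.one_le_rpow (by linarith) (by norm_num)
  have htp : t ^ 8 = p := by
    rw [ht, ← Real.rpow_mul_natCast hp_nonneg]
    norm_num
  have hpow : (p : ℝ) ^ (-(3 : ℝ) / 2) = (t ^ 12)⁻¹ := by
    rw [ht, ← Real.rpow_mul_natCast hp_nonneg, ← Real.rpow_neg hp_nonneg]
    norm_num
  have hu := norm_natCast_cpow_inv_le hp.one_le hα
  have hv := norm_natCast_cpow_inv_le hp.one_le hβ
  rw [← ht] at hu hv
  have hden := norm_add_one_sub_sub_ge hp2 ht1 htp hu hv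
  rw [Complex.ofReal_natCast] at hden
  have hden0 : (p : ℂ) + 1 - ((p : ℂ) ^ α)⁻¹ - ((p : ℂ) ^ β)⁻¹ ≠ 0 :=
    norm_pos_iff.mp (by linarith)
  have one_sub_le {u : ℂ} (h : ‖u‖ ≤ t) : ‖1 - u‖ ≤ 2 * t := by
    have := norm_sub_le 1 u
    rw [norm_one] at this
    linarith
  rw [Complex.cpow_add _ _ hp0, Complex.cpow_add _ _ hp0, Complex.cpow_add _ _ hp0,
    Complex.cpow_one, fraction_sub_one_div_eq hp0 (by simp [hp0]) (by simp [hp0]) hden0,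
    norm_div, norm_neg, norm_mul, norm_mul, Complex.norm_natCast, hpow]
  calc _ ≤ (2 * t) * (2 * t) / (p * (3 / 8 * p)) := by
        gcongr
        exacts [one_sub_le hu, one_sub_le hv]
    _ = 32 / 3 * (t ^ 14)⁻¹ := by
        rw [← htp]
        field_simp
        norm_num
    _ ≤ 11 * (t ^ 12)⁻¹ := by
        gcongr <;> norm_num [ht1]
end
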